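/- (Lemma 2.18(1).) Let m be a positive integer and k₀ a positive integer coprime to m, and set λ := k₀/m and S := #{i | 0 < w i ∧ m ∣ w i} − #{i | w i < 0 ∧ m ∣ w i}. Then there exists ε > 0 such that μ_{λ'} = μ_λ − S for every λ' ∈ (λ, λ + ε) and μ_{λ'} = μ_λ + S for every λ' ∈ (λ − ε, λ). In particular μ_{λ⁻} − μ_λ = μ_λ − μ_{λ⁺} = S = ∑_{b ≥ 1}(h_{mb} − h_{−mb}), where h_k := #{i | w i = k}. -/

import Mathlib

open Classical in
/-- The function 𝕎 from Equation (32): `𝕎(x) = 2x` if `x ∈ ℤ`, and `𝕎(x) = 2⌊x⌋ + 1` otherwise. -/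
noncomputable def W (x : ℝ) : ℤ :=
  if ∃ n : ℤ, (n : ℝ) = x then 2 * ⌊x⌋ else 2 * ⌊x⌋ + 1

/-- The Floer-theoretic index `μ_λ = ∑_{i : w i ≠ 0} (1 − 𝕎(λ·w i))`. -/
noncomputable def muLambda {ι : Type*} [Fintype ι] (w : ι → ℤ) (lam : ℝ) : ℤ :=
  ∑ i ∈ Finset.univ.filter (fun i => w i ≠ 0), (1 - W (lam * (w i : ℝ)))

/-- The Morse–Bott index `μ_α = 2·#{i | w i < 0}`. -/
noncomputable def muAlpha {ι : Type*} [Fintype ι] (w : ι → ℤ) : ℤ :=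
  2 * (Finset.univ.filter (fun i => w i < 0)).card

theorem W_intCast (n : ℤ) : W (n : ℝ) = 2 * n := by
  unfold W
  rw [if_pos ⟨n, rfl⟩, Int.floor_intCast]

theorem W_of_between (n : ℤ) (x : ℝ) (h1 : (n : ℝ) < x) (h2 : x < n + 1) :
    W x = 2 * n + 1 := by
  have hf : ⌊x⌋ = n := Int.floor_eq_iff.2 ⟨h1.le, h2⟩
  unfold W
  rw [if_neg, hf]
  rintro ⟨k, rfl⟩
  have a : n < k := by exact_mod_cast h1
  have b : k < n + 1 := by exact_mod_cast h2
  omega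

theorem W_near_int (n : ℤ) : ∀ᶠ y in nhds (n : ℝ),
    ((n : ℝ) < y → W y = W (n : ℝ) + 1) ∧ (y < n → W y = W (n : ℝ) - 1) := by
  have h1 : ∀ᶠ y in nhds (n : ℝ), y < (n : ℝ) + 1 := eventually_lt_nhds (by linarith)
  have h2 : ∀ᶠ y in nhds (n : ℝ), (n : ℝ) - 1 < y := eventually_gt_nhds (by linarith)
  filter_upwards [h1, h2] with y h1 h2
  rw [W_intCast]
  refine ⟨fun h => W_of_between n y h h1, fun h => ?_⟩
  rw [W_of_between (n - 1) y (by push_cast; exact h2) (by push_cast; linarith)]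
  ring

theorem W_near_nonint (x : ℝ) (hx : ¬ ∃ n : ℤ, (n : ℝ) = x) : ∀ᶠ y in nhds x, W y = W x := by
  have a : (⌊x⌋ : ℝ) < x := lt_of_le_of_ne (Int.floor_le x) (fun h => hx ⟨_, h⟩)
  have b := Int.lt_floor_add_one x
  filter_upwards [eventually_gt_nhds a, eventually_lt_nhds b] with y h1 h2
  rw [W_of_between _ y h1 h2, W_of_between _ x a b]

theorem int_iff (m k₀ : ℕ) (hm : 0 < m) (hcop : Nat.Coprime k₀ m) (v : ℤ) :
    (∃ n : ℤ, (n : ℝ) = (k₀ : ℝ) / m * v) ↔ (m : ℤ) ∣ v := by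
  have hm' : (m : ℝ) ≠ 0 := by positivity
  constructor
  · rintro ⟨n, hn⟩
    have h : (n : ℝ) * m = k₀ * v := by rw [hn]; field_simp
    have h' : n * m = k₀ * v := by exact_mod_cast h
    have hc : IsCoprime (m : ℤ) (k₀ : ℤ) := (Nat.isCoprime_iff_coprime.2 hcop).symm
    exact hc.dvd_of_dvd_mul_left ⟨n, by rw [← h']; ring⟩
  · rintro ⟨c, rfl⟩
    refine ⟨k₀ * c, ?_⟩
    push_cast
    field_simp

/-- The local contribution of a single weight to the jump. -/
def jumpTerm (m : ℕ) (v : ℤ) : ℤ :=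
  (if 0 < v ∧ (m : ℤ) ∣ v then 1 else 0) - (if v < 0 ∧ (m : ℤ) ∣ v then 1 else 0)

theorem W_jump (m k₀ : ℕ) (hm : 0 < m) (hcop : Nat.Coprime k₀ m) (v : ℤ) :
    ∀ᶠ l in nhds ((k₀ : ℝ) / m),
      ((k₀ : ℝ) / m < l → W (l * v) = W ((k₀ : ℝ) / m * v) + jumpTerm m v) ∧
      (l < (k₀ : ℝ) / m → W (l * v) = W ((k₀ : ℝ) / m * v) - jumpTerm m v) := by
  have ht : Filter.Tendsto (fun l : ℝ => l * (v : ℝ)) (nhds ((k₀ : ℝ) / m))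
      (nhds ((k₀ : ℝ) / m * v)) := (continuous_mul_const (v : ℝ)).tendsto _
  by_cases hd : (m : ℤ) ∣ v
  · obtain ⟨n, hn⟩ := (int_iff m k₀ hm hcop v).2 hd
    rw [← hn] at ht ⊢
    filter_upwards [ht.eventually (W_near_int n)] with l hl
    rw [hn] at hl ⊢
    rcases lt_trichotomy v 0 with hv | hv | hv
    · have hv' : (v : ℝ) < 0 := by exact_mod_cast hv
      have hj : jumpTerm m v = -1 := by simp [jumpTerm, hd, hv, hv.le]
      rw [hj]
      exact ⟨fun h => hl.2 (mul_lt_mul_of_neg_right h hv'),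
        fun h => hl.1 (mul_lt_mul_of_neg_right h hv')⟩
    · subst hv
      simp [jumpTerm]
    · have hv' : (0 : ℝ) < v := by exact_mod_cast hv
      have hj : jumpTerm m v = 1 := by simp [jumpTerm, hd, hv, hv.le]
      rw [hj]
      exact ⟨fun h => hl.1 (mul_lt_mul_of_pos_right h hv'),
        fun h => hl.2 (mul_lt_mul_of_pos_right h hv')⟩
  · have hx := mt (int_iff m k₀ hm hcop v).1 hd
    filter_upwards [ht.eventually (W_near_nonint _ hx)] with l hl
    simp [jumpTerm, hd, hl]

theorem sum_jumpTerm {ι : Type*} [Fintype ι] (w : ι → ℤ) (m : ℕ) :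
    (((Finset.univ.filter (fun i => 0 < w i ∧ (m : ℤ) ∣ w i)).card : ℤ)
      - ((Finset.univ.filter (fun i => w i < 0 ∧ (m : ℤ) ∣ w i)).card : ℤ))
    = ∑ i ∈ Finset.univ.filter (fun i => w i ≠ 0), jumpTerm m (w i) := by
  rw [Finset.sum_filter_of_ne]
  · simp only [jumpTerm, Finset.sum_sub_distrib, Finset.sum_boole]
  · intro i _ h h0
    exact h (by simp [jumpTerm, h0])

/-- Lemma 2.18(1): at a critical time `λ = k₀/m` (with `k₀, m` coprime), the index `μ_λ`
jumps by `S = ∑_{b ≥ 1}(h_{mb} − h_{−mb})` on either side: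
`μ_{λ⁺} = μ_λ − S` and `μ_{λ⁻} = μ_λ + S`. -/
theorem muLambda_jump {ι : Type*} [Fintype ι] (w : ι → ℤ) (m k₀ : ℕ)
    (hm : 0 < m) (hk : 0 < k₀) (hcop : Nat.Coprime k₀ m) :
    ∃ ε : ℝ, 0 < ε ∧
      (∀ lam' ∈ Set.Ioo ((k₀ : ℝ) / m) ((k₀ : ℝ) / m + ε),
        muLambda w lam' = muLambda w ((k₀ : ℝ) / m) -
          (((Finset.univ.filter (fun i => 0 < w i ∧ (m : ℤ) ∣ w i)).card : ℤ)
            - ((Finset.univ.filter (fun i => w i < 0 ∧ (m : ℤ) ∣ w i)).card : ℤ))) ∧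
      (∀ lam' ∈ Set.Ioo ((k₀ : ℝ) / m - ε) ((k₀ : ℝ) / m),
        muLambda w lam' = muLambda w ((k₀ : ℝ) / m) +
          (((Finset.univ.filter (fun i => 0 < w i ∧ (m : ℤ) ∣ w i)).card : ℤ)
            - ((Finset.univ.filter (fun i => w i < 0 ∧ (m : ℤ) ∣ w i)).card : ℤ))) := by
  have hall := Filter.eventually_all.2 (fun i => W_jump m k₀ hm hcop (w i))
  obtain ⟨ε, hε, h⟩ := Metric.eventually_nhds_iff.1 hall
  rw [sum_jumpTerm]
  refine ⟨ε, hε, fun l hl => ?_, fun l hl => ?_⟩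
  · have hd : dist l ((k₀ : ℝ) / m) < ε := by
      rw [Real.dist_eq, abs_lt]; constructor <;> linarith [hl.1, hl.2]
    unfold muLambda
    rw [← Finset.sum_sub_distrib]
    refine Finset.sum_congr rfl fun i _ => ?_
    rw [(h hd i).1 hl.1]; ring
  · have hd : dist l ((k₀ : ℝ) / m) < ε := by
      rw [Real.dist_eq, abs_lt]; constructor <;> linarith [hl.1, hl.2]
    unfold muLambda
    rw [← Finset.sum_add_distrib]
    refine Finset.sum_congr rfl fun i _ => ?_
    rw [(h hd i).2 hl.2]; ring
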